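/- arXiv:2510.04170 — 3 statements merged into one kernel-verified Lean document; each statement's English description precedes it below -/
import Mathlib

section
/- Let d be a positive natural number. For every y ∈ ℝ^d, the tensor-product translates of φ^b form a partition of unity: the sum over all k ∈ ℤ^d of the product ∏_{j=1}^d φ^b(y_j − 2 k_j) equals 1, where for each fixed y only finitely many terms are nonzero. -/
open Real

/-- The partition-of-unity profile `φᵇ`: equal to `1` for `|y| ≤ 3/4`,
to `(1 - sin(2π|y|))/2` for `3/4 ≤ |y| ≤ 5/4`, and to `0` otherwise. -/
noncomputable def phiB (y : ℝ) : ℝ :=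
  if |y| ≤ 3 / 4 then 1
  else if |y| ≤ 5 / 4 then (1 - Real.sin (2 * Real.pi * |y|)) / 2
  else 0

theorem phiB_of_abs_le {y : ℝ} (h : |y| ≤ 3 / 4) : phiB y = 1 := if_pos h

theorem phiB_of_le_abs {y : ℝ} (h : 5 / 4 ≤ |y|) : phiB y = 0 := by
  unfold phiB
  rw [if_neg (by linarith)]
  split_ifs with h'
  · rw [le_antisymm h' h, show 2 * π * (5 / 4) = π / 2 + 2 * π by ring, sin_add_two_pi,
      sin_pi_div_two]
    norm_num
  · rfl

theorem phiB_of_lt_abs_of_le {y : ℝ} (h₁ : 3 / 4 < |y|) (h₂ : |y| ≤ 5 / 4) :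
    phiB y = (1 - sin (2 * π * |y|)) / 2 := by
  rw [phiB, if_neg h₁.not_ge, if_pos h₂]

theorem phiB_add_phiB_sub_two {t : ℝ} (h₀ : 0 ≤ t) (h₂ : t ≤ 2) :
    phiB t + phiB (t - 2) = 1 := by
  have ht : |t| = t := abs_of_nonneg h₀
  have ht' : |t - 2| = 2 - t := by rw [abs_of_nonpos (by linarith)]; ring
  rcases le_or_gt t (3 / 4) with h | h
  · rw [phiB_of_abs_le (by linarith), phiB_of_le_abs (by linarith), add_zero]
  rcases lt_or_ge t (5 / 4) with h' | h'
  · rw [phiB_of_lt_abs_of_le (by linarith) (by linarith),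
      phiB_of_lt_abs_of_le (by linarith) (by linarith), ht, ht',
      show 2 * π * (2 - t) = -(2 * π * t) + 2 * π + 2 * π by ring, sin_add_two_pi,
      sin_add_two_pi, sin_neg]
    ring
  · rw [phiB_of_le_abs (by linarith), phiB_of_abs_le (by linarith), zero_add]

theorem mem_pair_floor_of_phiB_ne_zero {y : ℝ} {k : ℤ} (h : phiB (y - 2 * k) ≠ 0) :
    k ∈ ({⌊y / 2⌋, ⌊y / 2⌋ + 1} : Finset ℤ) := by
  have hlt : |y - 2 * k| < 5 / 4 := by
    by_contra! hle
    exact h (phiB_of_le_abs hle)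
  obtain ⟨h₁, h₂⟩ := abs_lt.mp hlt
  have h₃ := Int.floor_le (y / 2)
  have h₄ := Int.lt_floor_add_one (y / 2)
  have h₅ : ⌊y / 2⌋ - 1 < k := by
    have : ((⌊y / 2⌋ - 1 : ℤ) : ℝ) < k := by push_cast; linarith
    exact_mod_cast this
  have h₆ : k < ⌊y / 2⌋ + 2 := by
    have : (k : ℝ) < ((⌊y / 2⌋ + 2 : ℤ) : ℝ) := by push_cast; linarith
    exact_mod_cast this
  simp only [Finset.mem_insert, Finset.mem_singleton]
  lia

theorem sum_pair_floor_phiB (y : ℝ) :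
    ∑ k ∈ ({⌊y / 2⌋, ⌊y / 2⌋ + 1} : Finset ℤ), phiB (y - 2 * k) = 1 := by
  have h₁ := Int.floor_le (y / 2)
  have h₂ := Int.lt_floor_add_one (y / 2)
  rw [Finset.sum_pair (by lia)]
  push_cast
  rw [show y - 2 * ((⌊y / 2⌋ : ℝ) + 1) = y - 2 * ⌊y / 2⌋ - 2 by ring]
  exact phiB_add_phiB_sub_two (by linarith) (by linarith)

/-- For every `y ∈ ℝ^d`, the tensor-product translates
`∏_{j=1}^d φᵇ(y_j - 2 k_j)`, `k ∈ ℤ^d`, have only finitely many nonzero terms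
and sum to `1`: a partition of unity on the grid `2ℤ^d`. -/
theorem phiB_tensor_translates_partition_of_unity (d : ℕ) (hd : 0 < d)
    (y : Fin d → ℝ) :
    (Function.support fun k : Fin d → ℤ => ∏ j, phiB (y j - 2 * k j)).Finite ∧
    ∑ᶠ k : Fin d → ℤ, ∏ j, phiB (y j - 2 * k j) = 1 := by
  have hsub : (Function.support fun k : Fin d → ℤ => ∏ j, phiB (y j - 2 * k j)) ⊆
      (Fintype.piFinset fun j => ({⌊y j / 2⌋, ⌊y j / 2⌋ + 1} : Finset ℤ) :
        Finset (Fin d → ℤ)) := by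
    intro k hk
    rw [Finset.mem_coe, Fintype.mem_piFinset]
    exact fun j => mem_pair_floor_of_phiB_ne_zero
      (Finset.prod_ne_zero_iff.mp hk j (Finset.mem_univ j))
  refine ⟨(Finset.finite_toSet _).subset hsub, ?_⟩
  rw [finsum_eq_sum_of_support_subset _ hsub,
    ← Finset.prod_univ_sum (fun j => ({⌊y j / 2⌋, ⌊y j / 2⌋ + 1} : Finset ℤ))
      (fun j (k : ℤ) => phiB (y j - 2 * k))]
  exact Finset.prod_eq_one fun j _ => sum_pair_floor_phiB (y j)
end

section
/- Let ε ∈ (0,1), let J be a real m × n matrix, and let S be a real s × m matrix satisfying the subspace-embedding inequality (1 − ε)‖J x‖₂² ≤ ‖S J x‖₂² ≤ (1 + ε)‖J x‖₂² for all x ∈ ℝⁿ. Suppose S J = Q R with Qᵀ Q = Iₙ and R an invertible n × n matrix. Then the right-preconditioned matrix J R⁻¹ satisfies, for every y ∈ ℝⁿ, (1/√(1+ε)) ‖y‖₂ ≤ ‖J R⁻¹ y‖₂ ≤ (1/√(1−ε)) ‖y‖₂. Consequently the ratio of the largest to the smallest singular value of J R⁻¹ (its spectral condition number) is at most √((1+ε)/(1−ε)),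 independently of the condition number of J. -/
open Matrix

/-- Euclidean (ℓ²) norm of a finitely-indexed real vector. -/
noncomputable def euclNorm {ι : Type*} [Fintype ι] (v : ι → ℝ) : ℝ :=
  ‖(WithLp.equiv 2 (ι → ℝ)).symm v‖

theorem euclNorm_nonneg {ι : Type*} [Fintype ι] (v : ι → ℝ) : 0 ≤ euclNorm v :=
  norm_nonneg _

theorem euclNorm_sq {ι : Type*} [Fintype ι] (v : ι → ℝ) : euclNorm v ^ 2 = v ⬝ᵥ v := by
  rw [euclNorm, EuclideanSpace.norm_sq_eq]
  simp [dotProduct, ← pow_two]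

theorem euclNorm_mulVec_of_transpose_mul_self {ι κ : Type*} [Fintype ι] [Fintype κ]
    [DecidableEq κ] {Q : Matrix ι κ ℝ} (hQ : Qᵀ * Q = 1) (y : κ → ℝ) :
    euclNorm (Q.mulVec y) = euclNorm y := by
  rw [← sq_eq_sq₀ (euclNorm_nonneg _) (euclNorm_nonneg _), euclNorm_sq, euclNorm_sq,
    dotProduct_mulVec, ← mulVec_transpose, mulVec_mulVec, hQ, one_mulVec]

/-- If `S` is an `ε`-subspace embedding for the column space of `J` and
`S J = Q R` with `Qᵀ Q = Iₙ` and `R` invertible, then the right-preconditioned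
matrix `J R⁻¹` satisfies `(1/√(1+ε)) ‖y‖ ≤ ‖J R⁻¹ y‖ ≤ (1/√(1-ε)) ‖y‖` for all
`y`; consequently the ratio of its largest to smallest singular value is at
most `√((1+ε)/(1-ε))`, independent of `κ(J)`. -/
theorem sketched_preconditioner_conditioning {m n s : ℕ} (ε : ℝ)
    (hε : ε ∈ Set.Ioo (0 : ℝ) 1)
    (J : Matrix (Fin m) (Fin n) ℝ) (S : Matrix (Fin s) (Fin m) ℝ)
    (hemb : ∀ x : Fin n → ℝ,
      (1 - ε) * euclNorm (J.mulVec x) ^ 2 ≤ euclNorm ((S * J).mulVec x) ^ 2 ∧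
      euclNorm ((S * J).mulVec x) ^ 2 ≤ (1 + ε) * euclNorm (J.mulVec x) ^ 2)
    (Q : Matrix (Fin s) (Fin n) ℝ) (R : Matrix (Fin n) (Fin n) ℝ)
    (hQR : S * J = Q * R) (hQ : Qᵀ * Q = 1) (hR : IsUnit R) :
    (∀ y : Fin n → ℝ,
      (1 / Real.sqrt (1 + ε)) * euclNorm y ≤ euclNorm ((J * R⁻¹).mulVec y) ∧
      euclNorm ((J * R⁻¹).mulVec y) ≤ (1 / Real.sqrt (1 - ε)) * euclNorm y) ∧
    (∀ y z : Fin n → ℝ, euclNorm y = 1 → euclNorm z = 1 →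
      euclNorm ((J * R⁻¹).mulVec y) ≤
        Real.sqrt ((1 + ε) / (1 - ε)) * euclNorm ((J * R⁻¹).mulVec z)) := by
  obtain ⟨h0, h1⟩ := hε
  have hp : 0 < Real.sqrt (1 + ε) := Real.sqrt_pos.2 (by linarith)
  have hm : 0 < Real.sqrt (1 - ε) := Real.sqrt_pos.2 (by linarith)
  have bounds : ∀ y : Fin n → ℝ,
      (1 / Real.sqrt (1 + ε)) * euclNorm y ≤ euclNorm ((J * R⁻¹).mulVec y) ∧
      euclNorm ((J * R⁻¹).mulVec y) ≤ (1 / Real.sqrt (1 - ε)) * euclNorm y := by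
    intro y
    have hS : (S * J).mulVec (R⁻¹.mulVec y) = Q.mulVec y := by
      rw [hQR, mulVec_mulVec, Matrix.mul_assoc,
        Matrix.mul_nonsing_inv R ((Matrix.isUnit_iff_isUnit_det R).1 hR), Matrix.mul_one]
    have h := hemb (R⁻¹.mulVec y)
    rw [hS, euclNorm_mulVec_of_transpose_mul_self hQ, mulVec_mulVec] at h
    have hy := euclNorm_nonneg y
    have hJ := euclNorm_nonneg ((J * R⁻¹).mulVec y)
    rw [one_div_mul_eq_div, one_div_mul_eq_div, div_le_iff₀ hp, le_div_iff₀ hm]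
    constructor
    · refine (sq_le_sq₀ hy (by positivity)).1 ?_
      rw [mul_pow, Real.sq_sqrt (by linarith)]
      linarith [h.2]
    · refine (sq_le_sq₀ (by positivity) hy).1 ?_
      rw [mul_pow, Real.sq_sqrt (by linarith)]
      linarith [h.1]
  refine ⟨bounds, fun y z hy hz => ?_⟩
  have hu := (bounds y).2
  have hl := (bounds z).1
  rw [hy, mul_one] at hu
  rw [hz, mul_one] at hl
  calc euclNorm ((J * R⁻¹).mulVec y) ≤ 1 / Real.sqrt (1 - ε) := hu
    _ = Real.sqrt ((1 + ε) / (1 - ε)) * (1 / Real.sqrt (1 + ε)) := by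
      rw [Real.sqrt_div (by linarith)]
      field_simp
    _ ≤ _ := mul_le_mul_of_nonneg_left hl (Real.sqrt_nonneg _)
end

section
/- Let Re > 0 be a real number and define on ℝ² × ℝ the functions u(x,y,t) = 3/4 − 1/(4(1 + exp((−4x + 4y − t) Re / 32))) and v(x,y,t) = 3/4 + 1/(4(1 + exp((−4x + 4y − t) Re / 32))). Then (u, v) is an exact solution of the two-dimensional coupled viscous Burgers system with viscosity 1/Re: for all (x,y,t) ∈ ℝ³, ∂u/∂t + u ∂u/∂x + v ∂u/∂y = (1/Re)(∂²u/∂x² + ∂²u/∂y²) and ∂v/∂t + u ∂v/∂x + v ∂v/∂y = (1/Re)(∂²v/∂x² + ∂²v/∂y²). -/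
open Real

/-- The traveling-wave profile `1 / (4 (1 + exp((-4x + 4y - t) Re / 32)))`. -/
noncomputable def wBurgers (Re x y t : ℝ) : ℝ :=
  1 / (4 * (1 + Real.exp ((-4 * x + 4 * y - t) * Re / 32)))

/-- The Burgers velocity component `u = 3/4 - 1/(4(1 + exp((-4x+4y-t)Re/32)))`. -/
noncomputable def uBurgers (Re x y t : ℝ) : ℝ := 3 / 4 - wBurgers Re x y t

/-- The Burgers velocity component `v = 3/4 + 1/(4(1 + exp((-4x+4y-t)Re/32)))`. -/
noncomputable def vBurgers (Re x y t : ℝ) : ℝ := 3 / 4 + wBurgers Re x y t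

/-- Along any curve, `w = 1 / (4 (1 + exp f))` satisfies the logistic equation
`w' = -f' w (1 - 4 w)`. -/
theorem hasDerivAt_logistic_profile {f : ℝ → ℝ} {a s : ℝ} (hf : HasDerivAt f a s) :
    HasDerivAt (fun r => 1 / (4 * (1 + Real.exp (f r))))
      (-a * (1 / (4 * (1 + Real.exp (f s)))) * (1 - 4 * (1 / (4 * (1 + Real.exp (f s)))))) s := by
  have hpos : 1 + Real.exp (f s) ≠ 0 := by positivity
  refine ((hasDerivAt_const s (1 : ℝ)).div ((hf.exp.const_add 1).const_mul 4)
    (mul_ne_zero four_ne_zero hpos)).congr_deriv ?_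
  field_simp
  ring

theorem hasDerivAt_wBurgers_x (Re x y t : ℝ) :
    HasDerivAt (fun x' => wBurgers Re x' y t)
      (Re / 8 * wBurgers Re x y t * (1 - 4 * wBurgers Re x y t)) x := by
  have hf : HasDerivAt (fun x' : ℝ => (-4 * x' + 4 * y - t) * Re / 32) (-(Re / 8)) x := by
    refine ((((((hasDerivAt_id x).const_mul (-4)).add_const (4 * y)).sub_const t).mul_const
      Re).div_const 32).congr_deriv ?_
    ring
  exact (hasDerivAt_logistic_profile hf).congr_deriv (by simp only [neg_neg, wBurgers])

theorem hasDerivAt_wBurgers_y (Re x y t : ℝ) :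
    HasDerivAt (fun y' => wBurgers Re x y' t)
      (-(Re / 8) * wBurgers Re x y t * (1 - 4 * wBurgers Re x y t)) y := by
  have hf : HasDerivAt (fun y' : ℝ => (-4 * x + 4 * y' - t) * Re / 32) (Re / 8) y := by
    refine ((((((hasDerivAt_id y).const_mul 4).const_add (-4 * x)).sub_const t).mul_const
      Re).div_const 32).congr_deriv ?_
    ring
  exact hasDerivAt_logistic_profile hf

theorem hasDerivAt_wBurgers_t (Re x y t : ℝ) :
    HasDerivAt (fun t' => wBurgers Re x y t')
      (Re / 32 * wBurgers Re x y t * (1 - 4 * wBurgers Re x y t)) t := by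
  have hf : HasDerivAt (fun t' : ℝ => (-4 * x + 4 * y - t') * Re / 32) (-(Re / 32)) t := by
    refine ((((hasDerivAt_id t).const_sub (-4 * x + 4 * y)).mul_const Re).div_const
      32).congr_deriv ?_
    ring
  exact (hasDerivAt_logistic_profile hf).congr_deriv (by simp only [neg_neg, wBurgers])

/-- A solution of `w' = c w (1 - 4 w)` satisfies `w'' = c² w (1 - 4 w) (1 - 8 w)`. -/
theorem deriv_deriv_of_logistic {w : ℝ → ℝ} {c : ℝ}
    (hw : ∀ s, HasDerivAt w (c * w s * (1 - 4 * w s)) s) (s : ℝ) :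
    deriv (fun r => deriv w r) s = c ^ 2 * w s * (1 - 4 * w s) * (1 - 8 * w s) := by
  have hd : (fun r => deriv w r) = fun r => c * w r * (1 - 4 * w r) :=
    funext fun r => (hw r).deriv
  rw [hd]
  refine (((hw s).const_mul c).mul (((hw s).const_mul 4).const_sub 1)).deriv.trans ?_
  ring

/-- For every Reynolds number `Re > 0`, the pair `(u, v)` is an exact solution
of the two-dimensional coupled viscous Burgers system with viscosity `1/Re`:
`u_t + u u_x + v u_y = (1/Re)(u_xx + u_yy)` and
`v_t + u v_x + v v_y = (1/Re)(v_xx + v_yy)` at every point of `ℝ³`. -/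
theorem burgers_exact_solution (Re : ℝ) (hRe : 0 < Re) (x y t : ℝ) :
    (deriv (fun t' => uBurgers Re x y t') t +
        uBurgers Re x y t * deriv (fun x' => uBurgers Re x' y t) x +
        vBurgers Re x y t * deriv (fun y' => uBurgers Re x y' t) y =
      (1 / Re) *
        (deriv (fun x' => deriv (fun x'' => uBurgers Re x'' y t) x') x +
         deriv (fun y' => deriv (fun y'' => uBurgers Re x y'' t) y') y)) ∧
    (deriv (fun t' => vBurgers Re x y t') t +
        uBurgers Re x y t * deriv (fun x' => vBurgers Re x' y t) x +
        vBurgers Re x y t * deriv (fun y' => vBurgers Re x y' t) y =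
      (1 / Re) *
        (deriv (fun x' => deriv (fun x'' => vBurgers Re x'' y t) x') x +
         deriv (fun y' => deriv (fun y'' => vBurgers Re x y'' t) y') y)) := by
  have hx := (hasDerivAt_wBurgers_x Re x y t).deriv
  have hy := (hasDerivAt_wBurgers_y Re x y t).deriv
  have ht := (hasDerivAt_wBurgers_t Re x y t).deriv
  have hxx := deriv_deriv_of_logistic (fun r => hasDerivAt_wBurgers_x Re r y t) x
  have hyy := deriv_deriv_of_logistic (fun r => hasDerivAt_wBurgers_y Re x r t) y
  have hRe0 : Re ≠ 0 := hRe.ne'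
  simp only [uBurgers, vBurgers, deriv_const_sub, deriv_const_add, deriv.fun_neg, hx, hy, ht,
    hxx, hyy]
  constructor <;> field_simp <;> ring
end
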